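/- arXiv:2012.14946 — 2 statements merged into one kernel-verified Lean document; each statement's English description precedes it below -/
import Mathlib

section
/- Let λ_0, …, λ_5 be pairwise distinct complex numbers. Then Σ_{0≤i<j≤5} (λ_i + λ_j)^6 · P_3(λ_i,λ_j) / D_{ij} = 9. -/
open Finset in
/-- Bott denominator: `D_{ij} = ∏_{k ≠ i,j} (λ_i − λ_k)(λ_j − λ_k)`. -/
noncomputable def bottD {n : ℕ} (l : Fin n → ℂ) (i j : Fin n) : ℂ :=
  ∏ k ∈ (Finset.univ \ {i, j}), (l i - l k) * (l j - l k)

/-- `P_c(x,y) = Σ_{t=0}^{c−1} x^t y^{c−1−t}`. -/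
noncomputable def bottP (c : ℕ) (x y : ℂ) : ℂ :=
  ∑ t ∈ Finset.range c, x ^ t * y ^ (c - 1 - t)

/-- The Bott denominator in terms of the derivatives of the nodal polynomial at two nodes. -/
theorem bottD_mul_neg_sub_sq {n : ℕ} (l : Fin n → ℂ) {i j : Fin n} (hij : i ≠ j) :
    bottD l i j * -(l i - l j) ^ 2 =
      (∏ k ∈ Finset.univ.erase i, (l i - l k)) * ∏ k ∈ Finset.univ.erase j, (l j - l k) := by
  have hi : Finset.univ \ {i, j} = (Finset.univ.erase i).erase j := by
    ext k
    simp [and_comm]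
  have hj : Finset.univ \ {i, j} = (Finset.univ.erase j).erase i := by
    ext k
    simp
  have e₁ := Finset.mul_prod_erase (Finset.univ.erase i) (fun k => l i - l k)
    (Finset.mem_erase.2 ⟨hij.symm, Finset.mem_univ j⟩)
  have e₂ := Finset.mul_prod_erase (Finset.univ.erase j) (fun k => l j - l k)
    (Finset.mem_erase.2 ⟨hij, Finset.mem_univ i⟩)
  rw [← hi] at e₁
  rw [← hj] at e₂
  rw [bottD, Finset.prod_mul_distrib, ← e₁, ← e₂]
  ring

/-- Euler's identity: the weighted power sums of degree less than the number of nodes. -/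
theorem sum_pow_div_prod_erase_sub {n : ℕ} (l : Fin n → ℂ) (hl : Function.Injective l)
    {a : ℕ} (ha : a < n) :
    ∑ i, l i ^ a / ∏ k ∈ Finset.univ.erase i, (l i - l k) = if n - 1 = a then 1 else 0 := by
  have h := Lagrange.coeff_eq_sum (s := Finset.univ) (v := l) hl.injOn
    (P := (Polynomial.X : Polynomial ℂ) ^ a) (by simpa using ha)
  simpa [Polynomial.coeff_X_pow] using h.symm

/-- A symmetric function vanishing on the diagonal sums to twice its sum over increasing pairs. -/
theorem sum_sum_eq_two_mul_sum_filter_lt {ι R : Type*} [Fintype ι] [LinearOrder ι] [Semiring R]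
    (F : ι → ι → R) (hsymm : ∀ i j, F i j = F j i) (hdiag : ∀ i, F i i = 0) :
    ∑ i, ∑ j, F i j =
      2 * ∑ p ∈ Finset.univ.filter (fun p : ι × ι => p.1 < p.2), F p.1 p.2 := by
  have hgt : ∑ p ∈ Finset.univ.filter (fun p : ι × ι => ¬ p.1 < p.2), F p.1 p.2 =
      ∑ p ∈ Finset.univ.filter (fun p : ι × ι => p.2 < p.1), F p.1 p.2 := by
    refine (Finset.sum_subset (fun p hp => ?_) fun p hp hp' => ?_).symm
    · simpa using (Finset.mem_filter.1 hp).2.le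
    · have : p.1 = p.2 := by
        simp only [Finset.mem_filter, Finset.mem_univ, true_and, not_lt] at hp hp'
        exact le_antisymm hp' hp
      rw [this, hdiag]
  have hswap : ∑ p ∈ Finset.univ.filter (fun p : ι × ι => p.2 < p.1), F p.1 p.2 =
      ∑ p ∈ Finset.univ.filter (fun p : ι × ι => p.1 < p.2), F p.1 p.2 :=
    Finset.sum_equiv (Equiv.prodComm ι ι) (by simp) fun p _ => hsymm p.1 p.2
  rw [← Fintype.sum_prod_type' (f := F),
    ← Finset.sum_filter_add_sum_filter_not _ (fun p : ι × ι => p.1 < p.2), hgt, hswap, two_mul]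

/-- Bott's formula for `N_1(5,1,0,0) = 9` in ℙ⁵. -/
theorem bott_sum_10 (l : Fin 6 → ℂ) (hl : Function.Injective l) :
    ∑ p ∈ Finset.univ.filter (fun p : Fin 6 × Fin 6 => p.1 < p.2),
      (l p.1 + l p.2) ^ 6 * bottP 3 (l p.1) (l p.2) / bottD l p.1 p.2 = 9 := by
  set V : Fin 6 → ℂ := fun i => ∏ k ∈ Finset.univ.erase i, (l i - l k) with hV
  have hV0 (i : Fin 6) : V i ≠ 0 := Finset.prod_ne_zero_iff.2 fun k hk =>
    sub_ne_zero.2 fun h => (Finset.mem_erase.1 hk).1 (hl h).symm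
  set F : Fin 6 → Fin 6 → ℂ := fun i j =>
    (l i - l j) ^ 2 * (l i + l j) ^ 6 * bottP 3 (l i) (l j) / (V i * V j) with hF
  have hP (x y : ℂ) : bottP 3 x y = x ^ 2 + x * y + y ^ 2 := by
    simp [bottP, Finset.sum_range_succ]
    ring
  have hterm : ∑ p ∈ Finset.univ.filter (fun p : Fin 6 × Fin 6 => p.1 < p.2),
      (l p.1 + l p.2) ^ 6 * bottP 3 (l p.1) (l p.2) / bottD l p.1 p.2 =
      -∑ p ∈ Finset.univ.filter (fun p : Fin 6 × Fin 6 => p.1 < p.2), F p.1 p.2 := by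
    rw [← Finset.sum_neg_distrib]
    refine Finset.sum_congr rfl fun p hp => ?_
    have hne : p.1 ≠ p.2 := (Finset.mem_filter.1 hp).2.ne
    have hD : bottD l p.1 p.2 * -(l p.1 - l p.2) ^ 2 = V p.1 * V p.2 :=
      bottD_mul_neg_sub_sq l hne
    have hD0 : bottD l p.1 p.2 ≠ 0 :=
      left_ne_zero_of_mul (hD ▸ mul_ne_zero (hV0 p.1) (hV0 p.2))
    have hsub : l p.1 - l p.2 ≠ 0 := sub_ne_zero.2 (hl.ne hne)
    simp only [hF]
    rw [← hD]
    field_simp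
  have hsum : ∑ i, ∑ j, F i j = -18 := by
    have hexp (i j : Fin 6) : F i j =
        ∑ a : Fin 11, (![1, 5, 9, 4, -10, -18, -10, 4, 9, 5, 1] a : ℂ) *
          (l i ^ (a : ℕ) / V i * (l j ^ (10 - a : ℕ) / V j)) := by
      have := hV0 i
      have := hV0 j
      simp only [hF, hP, Fin.sum_univ_succ]
      simp
      field_simp
      ring
    have hS (a : ℕ) (ha : a < 6) : ∑ i, l i ^ a / V i = if 5 = a then 1 else 0 :=
      sum_pow_div_prod_erase_sub l hl ha
    have hfactor (a : Fin 11) : ∑ i, ∑ j, (![1, 5, 9, 4, -10, -18, -10, 4, 9, 5, 1] a : ℂ) *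
        (l i ^ (a : ℕ) / V i * (l j ^ (10 - a : ℕ) / V j)) = if a = 5 then -18 else 0 := by
      simp_rw [← Finset.mul_sum, ← Finset.sum_mul]
      rcases lt_trichotomy a 5 with h | rfl | h
      · rw [hS a (by omega), if_neg (by omega), if_neg h.ne]
        simp
      · have h5 := hS 5 (by norm_num)
        simp [h5]
      · rw [hS (10 - a) (by omega), if_neg (by omega), if_neg h.ne']
        simp
    simp_rw [hexp]
    rw [Finset.sum_congr rfl fun i _ => Finset.sum_comm, Finset.sum_comm,
      Finset.sum_congr rfl fun a _ => hfactor a]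
    simp
  have hhalf := sum_sum_eq_two_mul_sum_filter_lt F
    (fun i j => by simp only [hF, hP]; ring) (fun i => by simp [hF])
  rw [hterm]
  linear_combination (1 / 2 : ℂ) * hhalf - (1 / 2 : ℂ) * hsum
end

section
/- Let λ_0, …, λ_5 be pairwise distinct complex numbers. Then Σ_{0≤i<j≤5} (λ_i + λ_j)^2 · P_3(λ_i,λ_j)^3 / D_{ij} = 4. -/
open Finset in
/-- Euler's identity: `∑ i, l i ^ a / ∏ k ≠ i, (l i - l k)` is `1` if `a = n` and `0` if `a < n`,
where `n + 1` is the number of nodes. -/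
lemma sum_pow_div_prod_sub {K : Type*} [Field K] {n a : ℕ} {l : Fin (n + 1) → K}
    (hl : Function.Injective l) (ha : a ≤ n) :
    ∑ i, l i ^ a / ∏ k ∈ univ.erase i, (l i - l k) = if a = n then 1 else 0 := by
  have hdeg : (Polynomial.X ^ a : Polynomial K).degree < #(univ : Finset (Fin (n + 1))) := by
    rw [Polynomial.degree_X_pow, card_univ, Fintype.card_fin]
    exact_mod_cast Nat.lt_succ_of_le ha
  have h := Lagrange.coeff_eq_sum (v := l) hl.injOn hdeg
  simp only [card_univ, Fintype.card_fin, Nat.add_sub_cancel, Polynomial.coeff_X_pow,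
    Polynomial.eval_pow, Polynomial.eval_X] at h
  rw [← h]
  simp only [eq_comm]

open Finset in
lemma sum_sum_eq_two_mul_sum_lt {ι R : Type*} [Fintype ι] [LinearOrder ι] [CommRing R]
    (f : ι → ι → R) (hsymm : ∀ i j, f i j = f j i) (hdiag : ∀ i, f i i = 0) :
    ∑ i, ∑ j, f i j = 2 * ∑ p ∈ univ.filter (fun p : ι × ι => p.1 < p.2), f p.1 p.2 := by
  have hsplit : ∀ i j, f i j = (if i < j then f i j else 0) + (if j < i then f j i else 0) := by
    intro i j
    rcases lt_trichotomy i j with h | rfl | h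
    · simp [h, h.not_gt]
    · simp [hdiag]
    · simp [h, h.not_gt, hsymm i j]
  have hswap : ∑ i, ∑ j, (if j < i then f j i else 0) = ∑ i, ∑ j, if i < j then f i j else 0 :=
    sum_comm
  calc ∑ i, ∑ j, f i j
      = ∑ i, ∑ j, ((if i < j then f i j else 0) + (if j < i then f j i else 0)) :=
        sum_congr rfl fun i _ => sum_congr rfl fun j _ => hsplit i j
    _ = 2 * ∑ i, ∑ j, (if i < j then f i j else 0) := by
        simp only [sum_add_distrib]
        rw [hswap, two_mul]
    _ = _ := by rw [sum_filter, Fintype.sum_prod_type]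

open Finset in
lemma prod_sub_mul_prod_sub_eq_bottD {n : ℕ} (l : Fin n → ℂ) {i j : Fin n} (hij : i ≠ j) :
    (∏ k ∈ univ.erase i, (l i - l k)) * ∏ k ∈ univ.erase j, (l j - l k) =
      -(l i - l j) ^ 2 * bottD l i j := by
  have hi : (univ.erase i).erase j = univ \ {i, j} := by ext; simp; tauto
  have hj : (univ.erase j).erase i = univ \ {i, j} := by ext; simp
  rw [← mul_prod_erase (univ.erase i) _ (by simp [hij.symm] : j ∈ univ.erase i),
    ← mul_prod_erase (univ.erase j) _ (by simp [hij] : i ∈ univ.erase j), hi, hj, bottD,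
    prod_mul_distrib]
  ring

open Finset in
/-- Bott's formula for `N_1(1,3,0,0) = 4` in ℙ⁵. -/
theorem bott_sum_14 (l : Fin 6 → ℂ) (hl : Function.Injective l) :
    ∑ p ∈ Finset.univ.filter (fun p : Fin 6 × Fin 6 => p.1 < p.2),
      (l p.1 + l p.2) ^ 2 * (bottP 3 (l p.1) (l p.2)) ^ 3 / bottD l p.1 p.2 = 4 := by
  let w : Fin 6 → ℂ := fun i => ∏ k ∈ univ.erase i, (l i - l k)
  set g : ℂ → ℂ → ℂ := fun x y => -(x - y) ^ 2 * ((x + y) ^ 2 * bottP 3 x y ^ 3) with hg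
  let c : Fin 11 → ℂ := ![-1, -3, -4, -1, 5, 8, 5, -1, -4, -3, -1]
  have hexp : ∀ x y, g x y = ∑ a : Fin 11, c a * (x ^ (a : ℕ) * y ^ (10 - (a : ℕ))) := by
    intro x y
    simp [hg, bottP, c, Fin.sum_univ_succ, sum_range_succ]
    ring
  have hterm : ∀ i j, i < j →
      (l i + l j) ^ 2 * bottP 3 (l i) (l j) ^ 3 / bottD l i j = g (l i) (l j) / (w i * w j) := by
    intro i j hij
    have hsub : -(l i - l j) ^ 2 ≠ 0 :=
      neg_ne_zero.2 (pow_ne_zero 2 (sub_ne_zero.2 (hl.ne hij.ne)))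
    rw [prod_sub_mul_prod_sub_eq_bottD l hij.ne, mul_div_mul_left _ _ hsub]
  have hsum : ∀ a ≤ 5, ∑ i, l i ^ a / w i = if a = 5 then 1 else 0 :=
    fun a ha => sum_pow_div_prod_sub hl ha
  have hfull : ∑ i, ∑ j, g (l i) (l j) / (w i * w j) = 8 := by
    calc ∑ i, ∑ j, g (l i) (l j) / (w i * w j)
        = ∑ i, ∑ j, ∑ a : Fin 11,
            c a * ((l i ^ (a : ℕ) / w i) * (l j ^ (10 - (a : ℕ)) / w j)) := by
          refine sum_congr rfl fun i _ => sum_congr rfl fun j _ => ?_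
          rw [hexp, sum_div]
          refine sum_congr rfl fun a _ => ?_
          rw [div_mul_div_comm, mul_div_assoc]
      _ = ∑ a : Fin 11,
            c a * ((∑ i, l i ^ (a : ℕ) / w i) * ∑ j, l j ^ (10 - (a : ℕ)) / w j) := by
          simp_rw [sum_mul_sum, mul_sum]
          exact (sum_congr rfl fun i _ => sum_comm).trans sum_comm
      _ = c 5 * ((∑ i, l i ^ 5 / w i) * ∑ j, l j ^ 5 / w j) := by
          refine Fintype.sum_eq_single 5 fun a ha => ?_
          have ha' : (a : ℕ) ≠ 5 := fun h => ha (Fin.ext h)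
          rcases lt_or_gt_of_ne ha' with h | h
          · rw [hsum a h.le, if_neg ha', zero_mul, mul_zero]
          · rw [hsum (10 - a) (by lia), if_neg (by lia), mul_zero, mul_zero]
      _ = 8 := by
          rw [hsum 5 le_rfl]
          simp [c]
  rw [sum_congr rfl fun p hp => hterm p.1 p.2 (mem_filter.1 hp).2]
  rw [sum_sum_eq_two_mul_sum_lt (fun i j => g (l i) (l j) / (w i * w j))] at hfull
  · linear_combination hfull / 2
  · intro i j
    simp only [hg, bottP, sum_range_succ, sum_range_zero]
    rw [mul_comm (w i)]
    congr 1
    ring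
  · intro i
    simp [hg]
end
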